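/- arXiv:2002.12127 — 3 statements merged into one kernel-verified Lean document; each statement's English description precedes it below -/
import Mathlib

section
/- Let W be a real vector space equipped with a seminorm ‖·‖, let Q be a real vector space, and let b : W × Q → ℝ be bilinear. Let X_h ⊆ W be a subspace, Q_h ⊆ Q a subspace, and let I : W → W be a linear map with range contained in X_h such that ‖I z‖ ≤ ‖z‖ for all z ∈ W and b(I z, q) = b(z, q) for all z ∈ W and all q ∈ Q_h. Define V⁰_h = { v ∈ X_h : b(v, q) = 0 for all q ∈ Q_h }. Then for every w ∈ W with b(w, q) = 0 for all q ∈ Q_h, one has inf{ ‖w − w_h‖ : w_h ∈ V⁰_h } ≤ 2 · inf{ ‖w − v_h‖ : v_h ∈ X_h }. -/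
/-- Discretely divergence-constrained functions approximate continuously constrained ones
up to a factor `2` of the unconstrained best approximation, given a Fortin operator `I`
with stability constant `1`. -/
theorem stmt2 {W Q : Type*} [AddCommGroup W] [Module ℝ W] [AddCommGroup Q] [Module ℝ Q]
    (n : Seminorm ℝ W) (b : W →ₗ[ℝ] Q →ₗ[ℝ] ℝ)
    (Xh : Submodule ℝ W) (Qh : Submodule ℝ Q)
    (I : W →ₗ[ℝ] W) (hrange : ∀ z : W, I z ∈ Xh)
    (hstab : ∀ z : W, n (I z) ≤ n z)
    (hfortin : ∀ z : W, ∀ q ∈ Qh, b (I z) q = b z q)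
    (w : W) (hw : ∀ q ∈ Qh, b w q = 0) :
    sInf {r : ℝ | ∃ wh, (wh ∈ Xh ∧ ∀ q ∈ Qh, b wh q = 0) ∧ r = n (w - wh)} ≤
      2 * sInf {r : ℝ | ∃ vh ∈ Xh, r = n (w - vh)} := by
  have hinf : sInf {r : ℝ | ∃ wh, (wh ∈ Xh ∧ ∀ q ∈ Qh, b wh q = 0) ∧ r = n (w - wh)} / 2 ≤
      sInf {r : ℝ | ∃ vh ∈ Xh, r = n (w - vh)} := by
    refine le_csInf ⟨_, 0, Xh.zero_mem, rfl⟩ ?_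
    rintro _ ⟨vh, hvh, rfl⟩
    have hbdd : BddBelow
        {r : ℝ | ∃ wh, (wh ∈ Xh ∧ ∀ q ∈ Qh, b wh q = 0) ∧ r = n (w - wh)} := by
      refine ⟨0, ?_⟩
      rintro _ ⟨wh, -, rfl⟩
      exact apply_nonneg n _
    -- Correct `vh` by the Fortin interpolant of the error to restore the constraint.
    have hle : sInf {r : ℝ | ∃ wh, (wh ∈ Xh ∧ ∀ q ∈ Qh, b wh q = 0) ∧ r = n (w - wh)} ≤
        n (w - (vh + I (w - vh))) := by
      refine csInf_le hbdd ⟨_, ⟨Xh.add_mem hvh (hrange _), fun q hq => ?_⟩, rfl⟩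
      rw [map_add, LinearMap.add_apply, hfortin _ q hq, map_sub, LinearMap.sub_apply, hw q hq]
      ring
    have htri : n (w - (vh + I (w - vh))) ≤ n (w - vh) + n (I (w - vh)) := by
      rw [← sub_sub]
      exact map_sub_le_add n _ _
    linarith [hstab (w - vh)]
  linarith
end

section
/- Let p₁, p₂, p₃ ∈ ℝ² be affinely independent points forming a triangle, and suppose every interior angle of the triangle is at most φ̄ for some φ̄ < π (maximum angle condition). Then there exists a vertex p_k such that the 2×2 matrix N_k, whose columns are the unit vectors (p_j − p_k)/‖p_j − p_k‖ pointing from p_k towards the other two vertices p_j (j ≠ k), satisfies |det N_k| ≥ min(sin(π/3), sin(φ̄)) > 0; in particular the triangle has a regular vertex. -/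
open EuclideanGeometry

/-- The absolute value of the determinant of the matrix whose columns are the normalizations of
two nonzero plane vectors is the sine of the angle between them. -/
theorem abs_det_normalize_eq_sin_angle {x y : EuclideanSpace ℝ (Fin 2)}
    (hx : x ≠ 0) (hy : y ≠ 0) :
    |Matrix.det !![(‖x‖⁻¹ • x) 0, (‖y‖⁻¹ • y) 0; (‖x‖⁻¹ • x) 1, (‖y‖⁻¹ • y) 1]| =
      Real.sin (InnerProductGeometry.angle x y) := by
  have hx' : 0 < ‖x‖⁻¹ := inv_pos.2 (norm_pos_iff.2 hx)
  have hy' : 0 < ‖y‖⁻¹ := inv_pos.2 (norm_pos_iff.2 hy)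
  have h := InnerProductGeometry.sin_angle_mul_norm_mul_norm (‖x‖⁻¹ • x) (‖y‖⁻¹ • y)
  rw [InnerProductGeometry.angle_smul_left_of_pos _ _ hx',
    InnerProductGeometry.angle_smul_right_of_pos _ _ hy',
    norm_smul, norm_smul, norm_inv, norm_inv, norm_norm, norm_norm,
    inv_mul_cancel₀ (norm_ne_zero_iff.2 hx), inv_mul_cancel₀ (norm_ne_zero_iff.2 hy),
    mul_one, mul_one] at h
  rw [h, Matrix.det_fin_two_of, ← Real.sqrt_sq_eq_abs]
  congr 1
  simp only [PiLp.inner_apply, Fin.sum_univ_two, RCLike.inner_apply, conj_trivial]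
  ring

/-- Some interior angle of a nondegenerate triangle is at least `π / 3`. -/
theorem exists_pi_div_three_le_angle {V P : Type*} [NormedAddCommGroup V]
    [InnerProductSpace ℝ V] [MetricSpace P] [NormedAddTorsor V P] {p : Fin 3 → P}
    (hp : Function.Injective p) :
    ∃ i k j : Fin 3, i ≠ k ∧ j ≠ k ∧ i ≠ j ∧ Real.pi / 3 ≤ ∠ (p i) (p k) (p j) := by
  by_contra! h
  have hsum := EuclideanGeometry.angle_add_angle_add_angle_eq_pi (p 2)
    (hp.ne (show (1 : Fin 3) ≠ 0 by decide))
  have h₁ := h 0 1 2 (by decide) (by decide) (by decide)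
  have h₂ := h 1 2 0 (by decide) (by decide) (by decide)
  have h₀ := h 2 0 1 (by decide) (by decide) (by decide)
  linarith

/-- In two dimensions, the maximum angle condition implies the regular vertex property:
if all interior angles of a triangle are at most `φ̄ < π`, then some vertex `p k` is regular
with constant `min (sin (π/3)) (sin φ̄) > 0`, where the matrix `N k` has as columns the
unit vectors pointing from `p k` towards the other two vertices. -/
theorem stmt5 (p : Fin 3 → EuclideanSpace ℝ (Fin 2))
    (hind : AffineIndependent ℝ p)
    (φ : ℝ) (hφ : φ < Real.pi)
    (hangles : ∀ i j k : Fin 3, i ≠ j → j ≠ k → i ≠ k →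
      EuclideanGeometry.angle (p i) (p j) (p k) ≤ φ) :
    ∃ k j₁ j₂ : Fin 3, j₁ ≠ k ∧ j₂ ≠ k ∧ j₁ ≠ j₂ ∧
      0 < min (Real.sin (Real.pi / 3)) (Real.sin φ) ∧
      min (Real.sin (Real.pi / 3)) (Real.sin φ) ≤
        |Matrix.det
          !![(‖p j₁ - p k‖⁻¹ • (p j₁ - p k)) 0, (‖p j₂ - p k‖⁻¹ • (p j₂ - p k)) 0;
             (‖p j₁ - p k‖⁻¹ • (p j₁ - p k)) 1, (‖p j₂ - p k‖⁻¹ • (p j₂ - p k)) 1]| := by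
  obtain ⟨i, k, j, hik, hjk, hij, hge⟩ := exists_pi_div_three_le_angle hind.injective
  have hle := hangles i k j hik hjk.symm hij
  have hpi := Real.pi_pos
  refine ⟨k, i, j, hik, hjk, hij, lt_min ?_ ?_, ?_⟩
  · exact Real.sin_pos_of_pos_of_lt_pi (by linarith) (by linarith)
  · exact Real.sin_pos_of_pos_of_lt_pi (by linarith) hφ
  · rw [abs_det_normalize_eq_sin_angle (sub_ne_zero.2 (hind.injective.ne hik))
      (sub_ne_zero.2 (hind.injective.ne hjk))]
    exact strictConcaveOn_sin_Icc.concaveOn.min_le_of_mem_Icc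
      ⟨by linarith, by linarith⟩ ⟨by linarith, hφ.le⟩ ⟨hge, hle⟩
end

section
/- Let ω = 3π/2 and let λ ∈ (0,1) satisfy sin(ωλ) = λ. Let Ω = {(r cos φ, r sin φ, z) : 0 < r < 1, 0 < φ < ω, 0 < z < 1} ⊂ ℝ³; for (x,y,z) ∈ Ω write r = √(x² + y²) and φ ∈ (0,ω) for the unique angle with x = r cos φ, y = r sin φ. Define u = (u₁, u₂, u₃) : Ω → ℝ³ by u₁ = z r^λ [−λ sin(φ) cos(λ(ω−φ)+φ) + λ sin(ω−φ) cos(λφ−φ) + sin(λ(ω−φ))], u₂ = z r^λ [sin(λφ) − λ sin(φ) sin(λ(ω−φ)+φ) − λ sin(ω−φ) sin(λφ−φ)], u₃ = r^{2/3} sin(2φ/3), and p : Ω → ℝ by p = 2λ z r^{λ−1} [sin((λ−1)φ + ω) + sin((λ−1)φ − λω)]. Then on Ω the vector field f = −Δu + ∇p has vanishing first and second components, i.e. Δu₁ = ∂p/∂x, Δu₂ = ∂p/∂y, Δu₃ = 0, so that f = (0, 0, ∂p/∂z) with ∂p/∂z = 2λ r^{λ−1}[sin((λ−1)φ+ω)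 + sin((λ−1)φ−λω)]. -/
open Real

/-- The polar angle in `(0, 2π]` of the point `(x, y)`: the unique angle `φ` with
`x = r cos φ`, `y = r sin φ` for points of the sector `0 < φ < 3π/2`. -/
noncomputable def sphi (x y : ℝ) : ℝ :=
  if 0 < Complex.arg (⟨x, y⟩ : ℂ) then Complex.arg (⟨x, y⟩ : ℂ)
  else Complex.arg (⟨x, y⟩ : ℂ) + 2 * π

/-- The polar radius `r = √(x² + y²)`. -/
noncomputable def srad (x y : ℝ) : ℝ := Real.sqrt (x ^ 2 + y ^ 2)

/-- First velocity component of the 3D example (Cartesian coordinates, `ω = 3π/2`). -/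
noncomputable def u1 (l x y z : ℝ) : ℝ :=
  z * srad x y ^ l *
    (-l * Real.sin (sphi x y) * Real.cos (l * (3 * π / 2 - sphi x y) + sphi x y)
      + l * Real.sin (3 * π / 2 - sphi x y) * Real.cos (l * sphi x y - sphi x y)
      + Real.sin (l * (3 * π / 2 - sphi x y)))

/-- Second velocity component of the 3D example. -/
noncomputable def u2 (l x y z : ℝ) : ℝ :=
  z * srad x y ^ l *
    (Real.sin (l * sphi x y)
      - l * Real.sin (sphi x y) * Real.sin (l * (3 * π / 2 - sphi x y) + sphi x y)
      - l * Real.sin (3 * π / 2 - sphi x y) * Real.sin (l * sphi x y - sphi x y))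

/-- Third velocity component of the 3D example. -/
noncomputable def u3 (x y z : ℝ) : ℝ :=
  srad x y ^ ((2 : ℝ) / 3) * Real.sin (2 * sphi x y / 3)

/-- Pressure `p = 2λ z r^{λ−1}[sin((λ−1)φ+ω) + sin((λ−1)φ−λω)]` of the 3D example. -/
noncomputable def pres (l x y z : ℝ) : ℝ :=
  2 * l * z * srad x y ^ (l - 1) *
    (Real.sin ((l - 1) * sphi x y + 3 * π / 2)
      + Real.sin ((l - 1) * sphi x y - l * (3 * π / 2)))

open Filter Topology

/-- Membership in the plane cut along the half-line `{x ≥ 0, y = 0}`. -/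
def OffAxis (x y : ℝ) : Prop := x < 0 ∨ y ≠ 0

lemma OffAxis.eventually_left {x y : ℝ} (h : OffAxis x y) : ∀ᶠ t in 𝓝 x, OffAxis t y := by
  rcases h with h | h
  · filter_upwards [Iio_mem_nhds h] with t ht using Or.inl ht
  · exact Eventually.of_forall fun _ => Or.inr h

lemma OffAxis.eventually_right {x y : ℝ} (h : OffAxis x y) : ∀ᶠ t in 𝓝 y, OffAxis x t := by
  rcases h with h | h
  · exact Eventually.of_forall fun _ => Or.inl h
  · filter_upwards [isOpen_ne.mem_nhds h] with t ht using Or.inr ht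

lemma OffAxis.sq_add_sq_pos {x y : ℝ} (h : OffAxis x y) : 0 < x ^ 2 + y ^ 2 := by
  rcases h with h | h
  · nlinarith [sq_nonneg y, mul_pos_of_neg_of_neg h h]
  · positivity

lemma OffAxis.srad_pos {x y : ℝ} (h : OffAxis x y) : 0 < srad x y :=
  Real.sqrt_pos.2 h.sq_add_sq_pos

lemma OffAxis.srad_sq {x y : ℝ} (h : OffAxis x y) : srad x y ^ 2 = x ^ 2 + y ^ 2 :=
  Real.sq_sqrt h.sq_add_sq_pos.le

lemma srad_eq_norm (x y : ℝ) : srad x y = ‖(⟨x, y⟩ : ℂ)‖ := by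
  rw [srad, Complex.norm_def, Complex.normSq_mk]
  ring_nf

lemma srad_mul_cos_sphi (x y : ℝ) : srad x y * Real.cos (sphi x y) = x := by
  have h := Complex.norm_mul_cos_arg (⟨x, y⟩ : ℂ)
  rw [srad_eq_norm, sphi]
  split_ifs
  · exact h
  · rw [Real.cos_add_two_pi]; exact h

lemma srad_mul_sin_sphi (x y : ℝ) : srad x y * Real.sin (sphi x y) = y := by
  have h := Complex.norm_mul_sin_arg (⟨x, y⟩ : ℂ)
  rw [srad_eq_norm, sphi]
  split_ifs
  · exact h
  · rw [Real.sin_add_two_pi]; exact h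

lemma OffAxis.neg_mem_slitPlane {x y : ℝ} (h : OffAxis x y) :
    (⟨-x, -y⟩ : ℂ) ∈ Complex.slitPlane := by
  rcases h with h | h
  · exact Or.inl (by simpa using h)
  · exact Or.inr (by simpa using h)

lemma OffAxis.sphi_eq {x y : ℝ} (h : OffAxis x y) :
    sphi x y = (Complex.log ⟨-x, -y⟩).im + π := by
  have hneg : (⟨-x, -y⟩ : ℂ) = -⟨x, y⟩ := by apply Complex.ext <;> simp
  rw [Complex.log_im, hneg, sphi]
  rcases lt_trichotomy y 0 with hy | rfl | hy
  · rw [Complex.arg_neg_eq_arg_add_pi_of_im_neg (by simpa using hy),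
      if_neg (not_lt.2 (Complex.arg_neg_iff.2 (by simpa using hy)).le)]
    ring
  · have hx : x < 0 := by simpa [OffAxis] using h
    have h1 : Complex.arg (⟨x, 0⟩ : ℂ) = π := Complex.arg_eq_pi_iff.2 ⟨hx, rfl⟩
    have h2 : Complex.arg (-⟨x, 0⟩ : ℂ) = 0 :=
      Complex.arg_eq_zero_iff.2 ⟨by simpa using hx.le, by simp⟩
    rw [h1, h2, if_pos Real.pi_pos, zero_add]
  · rw [Complex.arg_neg_eq_arg_sub_pi_of_im_pos (by simpa using hy), if_pos]
    · ring
    · refine lt_of_le_of_ne (Complex.arg_nonneg_iff.2 (by simpa using hy.le)) fun h0 => ?_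
      exact hy.ne' (Complex.arg_eq_zero_iff.1 h0.symm).2

lemma OffAxis.hasDerivAt_sphi_left {x y : ℝ} (h : OffAxis x y) :
    HasDerivAt (fun t => sphi t y) (-Real.sin (sphi x y) / srad x y) x := by
  have h1 : HasDerivAt (fun t : ℝ => (⟨-t, -y⟩ : ℂ)) (-1) x := by
    have heq : (fun t : ℝ => (⟨-t, -y⟩ : ℂ)) = -fun t : ℝ => (↑(id t) : ℂ) + y * Complex.I := by
      funext t; apply Complex.ext <;> simp
    rw [heq]
    exact (((hasDerivAt_id x).ofReal_comp.add_const ((y : ℂ) * Complex.I)).neg).congr_deriv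
      (by simp)
  have h2 := (h1.clog_real h.neg_mem_slitPlane)
  have h3 := (Complex.imCLM.hasFDerivAt.comp_hasDerivAt x h2).add_const π
  have h4 : HasDerivAt (fun t => sphi t y) (Complex.imCLM (-1 / (⟨-x, -y⟩ : ℂ))) x :=
    h3.congr_of_eventuallyEq (h.eventually_left.mono fun t ht => ht.sphi_eq)
  convert h4 using 1
  have h5 := h.srad_sq
  have hr := h.srad_pos.ne'
  have h6 := srad_mul_sin_sphi x y
  rw [Complex.imCLM_apply, Complex.div_im, Complex.normSq_mk]
  simp only [Complex.neg_im, Complex.one_im, Complex.neg_re, Complex.one_re]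
  rw [show -x * -x + -y * -y = srad x y ^ 2 by rw [h5]; ring]
  field_simp
  linarith

lemma OffAxis.hasDerivAt_sphi_right {x y : ℝ} (h : OffAxis x y) :
    HasDerivAt (fun t => sphi x t) (Real.cos (sphi x y) / srad x y) y := by
  have h1 : HasDerivAt (fun t : ℝ => (⟨-x, -t⟩ : ℂ)) (-Complex.I) y := by
    have heq : (fun t : ℝ => (⟨-x, -t⟩ : ℂ)) = -fun t : ℝ => (x : ℂ) + ↑(id t) * Complex.I := by
      funext t; apply Complex.ext <;> simp
    rw [heq]
    exact ((((hasDerivAt_id y).ofReal_comp.mul_const Complex.I).const_add (x : ℂ)).neg).congr_deriv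
      (by simp)
  have h2 := (h1.clog_real h.neg_mem_slitPlane)
  have h3 := (Complex.imCLM.hasFDerivAt.comp_hasDerivAt y h2).add_const π
  have h4 : HasDerivAt (fun t => sphi x t) (Complex.imCLM (-Complex.I / (⟨-x, -y⟩ : ℂ))) y :=
    h3.congr_of_eventuallyEq (h.eventually_right.mono fun t ht => ht.sphi_eq)
  convert h4 using 1
  have h5 := h.srad_sq
  have hr := h.srad_pos.ne'
  have h6 := srad_mul_cos_sphi x y
  rw [Complex.imCLM_apply, Complex.div_im, Complex.normSq_mk]
  simp only [Complex.neg_im, Complex.I_im, Complex.neg_re, Complex.I_re]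
  rw [show -x * -x + -y * -y = srad x y ^ 2 by rw [h5]; ring]
  field_simp
  linarith

lemma OffAxis.hasDerivAt_srad_left {x y : ℝ} (h : OffAxis x y) :
    HasDerivAt (fun t => srad t y) (Real.cos (sphi x y)) x := by
  have h1 := (((hasDerivAt_id x).pow 2).add_const (y ^ 2)).sqrt h.sq_add_sq_pos.ne'
  refine h1.congr_deriv ?_
  have hr := h.srad_pos.ne'
  have h6 := srad_mul_cos_sphi x y
  change _ / (2 * srad x y) = _
  simp only [id, Nat.cast_ofNat, Nat.add_one_sub_one, pow_one, mul_one]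
  field_simp
  linarith

lemma OffAxis.hasDerivAt_srad_right {x y : ℝ} (h : OffAxis x y) :
    HasDerivAt (fun t => srad x t) (Real.sin (sphi x y)) y := by
  have h1 := (((hasDerivAt_id y).pow 2).const_add (x ^ 2)).sqrt h.sq_add_sq_pos.ne'
  refine h1.congr_deriv ?_
  have hr := h.srad_pos.ne'
  have h6 := srad_mul_sin_sphi x y
  change _ / (2 * srad x y) = _
  simp only [id, Nat.cast_ofNat, Nat.add_one_sub_one, pow_one, mul_one]
  field_simp
  linarith

lemma OffAxis.hasDerivAt_polar_left {x y : ℝ} (h : OffAxis x y) (a : ℝ) {g : ℝ → ℝ} {g' : ℝ}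
    (hg : HasDerivAt g g' (sphi x y)) :
    HasDerivAt (fun t => srad t y ^ a * g (sphi t y))
      (srad x y ^ (a - 1) *
        (a * Real.cos (sphi x y) * g (sphi x y) - Real.sin (sphi x y) * g')) x := by
  have h1 := h.hasDerivAt_srad_left.rpow_const (p := a) (Or.inl h.srad_pos.ne')
  have h2 := h1.mul (hg.comp x h.hasDerivAt_sphi_left)
  refine h2.congr_deriv ?_
  have hr := h.srad_pos.ne'
  have h3 : srad x y ^ a = srad x y ^ (a - 1) * srad x y := by
    rw [Real.rpow_sub_one hr]; field_simp
  simp only [Function.comp, h3]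
  field_simp
  ring

lemma OffAxis.hasDerivAt_polar_right {x y : ℝ} (h : OffAxis x y) (a : ℝ) {g : ℝ → ℝ} {g' : ℝ}
    (hg : HasDerivAt g g' (sphi x y)) :
    HasDerivAt (fun t => srad x t ^ a * g (sphi x t))
      (srad x y ^ (a - 1) *
        (a * Real.sin (sphi x y) * g (sphi x y) + Real.cos (sphi x y) * g')) y := by
  have h1 := h.hasDerivAt_srad_right.rpow_const (p := a) (Or.inl h.srad_pos.ne')
  have h2 := h1.mul (hg.comp y h.hasDerivAt_sphi_right)
  refine h2.congr_deriv ?_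
  have hr := h.srad_pos.ne'
  have h3 : srad x y ^ a = srad x y ^ (a - 1) * srad x y := by
    rw [Real.rpow_sub_one hr]; field_simp
  simp only [Function.comp, h3]
  field_simp

/-- The Laplacian in polar coordinates of `r ^ a * g φ`. -/
lemma OffAxis.laplacian_polar {x y : ℝ} (h : OffAxis x y) (a : ℝ) {g g₁ g₂ : ℝ → ℝ}
    (hg : ∀ s, HasDerivAt g (g₁ s) s) (hg₁ : ∀ s, HasDerivAt g₁ (g₂ s) s) :
    deriv (deriv fun t => srad t y ^ a * g (sphi t y)) x
        + deriv (deriv fun t => srad x t ^ a * g (sphi x t)) y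
      = srad x y ^ (a - 2) * (a ^ 2 * g (sphi x y) + g₂ (sphi x y)) := by
  have hx : deriv (fun t => srad t y ^ a * g (sphi t y)) =ᶠ[𝓝 x] fun t => srad t y ^ (a - 1) *
      (fun s => a * Real.cos s * g s - Real.sin s * g₁ s) (sphi t y) :=
    h.eventually_left.mono fun t ht => (ht.hasDerivAt_polar_left a (hg _)).deriv
  have hy : deriv (fun t => srad x t ^ a * g (sphi x t)) =ᶠ[𝓝 y] fun t => srad x t ^ (a - 1) *
      (fun s => a * Real.sin s * g s + Real.cos s * g₁ s) (sphi x t) :=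
    h.eventually_right.mono fun t ht => (ht.hasDerivAt_polar_right a (hg _)).deriv
  set θ := sphi x y
  have dx : HasDerivAt (fun s => a * Real.cos s * g s - Real.sin s * g₁ s) _ θ :=
    (((Real.hasDerivAt_cos θ).const_mul a).mul (hg θ)).sub
    ((Real.hasDerivAt_sin θ).mul (hg₁ θ))
  have dy : HasDerivAt (fun s => a * Real.sin s * g s + Real.cos s * g₁ s) _ θ :=
    (((Real.hasDerivAt_sin θ).const_mul a).mul (hg θ)).add
    ((Real.hasDerivAt_cos θ).mul (hg₁ θ))
  rw [hx.deriv_eq, hy.deriv_eq, (h.hasDerivAt_polar_left (a - 1) dx).deriv,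
    (h.hasDerivAt_polar_right (a - 1) dy).deriv, show a - 1 - 1 = a - 2 by ring]
  linear_combination srad x y ^ (a - 2) * (a ^ 2 * g θ + g₂ θ) * Real.sin_sq_add_cos_sq θ

lemma hasDerivAt_sin_add_cos (k A B s : ℝ) :
    HasDerivAt (fun s => A * Real.sin (k * s) + B * Real.cos (k * s))
      (-(k * B) * Real.sin (k * s) + k * A * Real.cos (k * s)) s := by
  have h := (hasDerivAt_id s).const_mul k
  refine ((h.sin.const_mul A).add (h.cos.const_mul B)).congr_deriv ?_
  simp only [id]
  ring

/-- The Laplacian of a homogeneous biharmonic function of degree `a`. -/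
lemma OffAxis.laplacian_biharmonic {x y : ℝ} (h : OffAxis x y) (a A B C D : ℝ)
    {F : ℝ → ℝ → ℝ}
    (hF : ∀ x y, F x y = srad x y ^ a *
      (A * Real.sin (a * sphi x y) + B * Real.cos (a * sphi x y)
        + (C * Real.sin ((a - 2) * sphi x y) + D * Real.cos ((a - 2) * sphi x y)))) :
    deriv (deriv fun t => F t y) x + deriv (deriv fun t => F x t) y
      = 4 * (a - 1) * srad x y ^ (a - 2) *
        (C * Real.sin ((a - 2) * sphi x y) + D * Real.cos ((a - 2) * sphi x y)) := by
  simp only [hF]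
  have h1 := fun s => (hasDerivAt_sin_add_cos a A B s).add (hasDerivAt_sin_add_cos (a - 2) C D s)
  have h2 := fun s => (hasDerivAt_sin_add_cos a (-(a * B)) (a * A) s).add
    (hasDerivAt_sin_add_cos (a - 2) (-((a - 2) * D)) ((a - 2) * C) s)
  refine (h.laplacian_polar a h1 h2).trans ?_
  simp only [Pi.add_apply]
  ring

/-- The partial derivative in `x` of a homogeneous harmonic function of degree `a`. -/
lemma OffAxis.deriv_harmonic_left {x y : ℝ} (h : OffAxis x y) (a E G : ℝ) {F : ℝ → ℝ → ℝ}
    (hF : ∀ x y, F x y = srad x y ^ a *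
      (E * Real.sin (a * sphi x y) + G * Real.cos (a * sphi x y))) :
    deriv (fun t => F t y) x = a * srad x y ^ (a - 1) *
      (E * Real.sin ((a - 1) * sphi x y) + G * Real.cos ((a - 1) * sphi x y)) := by
  simp only [hF]
  rw [(h.hasDerivAt_polar_left a (hasDerivAt_sin_add_cos a E G _)).deriv,
    sub_one_mul, Real.sin_sub, Real.cos_sub]
  ring

/-- The partial derivative in `y` of a homogeneous harmonic function of degree `a`. -/
lemma OffAxis.deriv_harmonic_right {x y : ℝ} (h : OffAxis x y) (a E G : ℝ) {F : ℝ → ℝ → ℝ}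
    (hF : ∀ x y, F x y = srad x y ^ a *
      (E * Real.sin (a * sphi x y) + G * Real.cos (a * sphi x y))) :
    deriv (fun t => F x t) y = a * srad x y ^ (a - 1) *
      (-G * Real.sin ((a - 1) * sphi x y) + E * Real.cos ((a - 1) * sphi x y)) := by
  simp only [hF]
  rw [(h.hasDerivAt_polar_right a (hasDerivAt_sin_add_cos a E G _)).deriv,
    sub_one_mul, Real.sin_sub, Real.cos_sub]
  ring

lemma sin_three_pi_div_two_sub (s : ℝ) : Real.sin (3 * π / 2 - s) = -Real.cos s := by
  rw [show 3 * π / 2 - s = π / 2 - s + π by ring, Real.sin_add_pi, Real.sin_pi_div_two_sub]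

lemma sin_add_three_pi_div_two (s : ℝ) : Real.sin (s + 3 * π / 2) = -Real.cos s := by
  rw [show s + 3 * π / 2 = s + π / 2 + π by ring, Real.sin_add_pi, Real.sin_add_pi_div_two]

lemma u1_eq (l z x y : ℝ) : u1 l x y z = srad x y ^ l *
    (-(z * (l / 2 + 1) * Real.cos (l * (3 * π / 2))) * Real.sin (l * sphi x y)
      + z * ((l / 2 + 1) * Real.sin (l * (3 * π / 2)) - l / 2) * Real.cos (l * sphi x y)
      + (z * (l / 2) * Real.cos (l * (3 * π / 2)) * Real.sin ((l - 2) * sphi x y)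
      + -(z * (l / 2) * (1 + Real.sin (l * (3 * π / 2)))) * Real.cos ((l - 2) * sphi x y))) := by
  rw [u1]
  generalize sphi x y = s
  rw [sin_three_pi_div_two_sub, mul_sub l, sub_mul, two_mul]
  generalize l * (3 * π / 2) = w
  rw [show l * s - (s + s) = l * s - s - s by ring]
  simp only [Real.cos_add, Real.sin_sub, Real.cos_sub]
  have h := Real.sin_sq_add_cos_sq s
  generalize srad x y ^ l = R
  grind

lemma u2_eq (l z x y : ℝ) : u2 l x y z = srad x y ^ l *
    (z * (1 + l / 2 - l / 2 * Real.sin (l * (3 * π / 2))) * Real.sin (l * sphi x y)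
      + -(z * (l / 2) * Real.cos (l * (3 * π / 2))) * Real.cos (l * sphi x y)
      + (z * (l / 2) * (1 + Real.sin (l * (3 * π / 2))) * Real.sin ((l - 2) * sphi x y)
      + z * (l / 2) * Real.cos (l * (3 * π / 2)) * Real.cos ((l - 2) * sphi x y))) := by
  rw [u2]
  generalize sphi x y = s
  rw [sin_three_pi_div_two_sub, mul_sub l, sub_mul, two_mul]
  generalize l * (3 * π / 2) = w
  rw [show l * s - (s + s) = l * s - s - s by ring]
  simp only [Real.sin_add, Real.sin_sub, Real.cos_sub]
  have h := Real.sin_sq_add_cos_sq s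
  generalize srad x y ^ l = R
  grind

lemma u3_eq (z x y : ℝ) : u3 x y z = srad x y ^ ((2 : ℝ) / 3) *
    (1 * Real.sin (2 / 3 * sphi x y) + 0 * Real.cos (2 / 3 * sphi x y)
      + (0 * Real.sin ((2 / 3 - 2) * sphi x y) + 0 * Real.cos ((2 / 3 - 2) * sphi x y))) := by
  rw [u3, mul_div_right_comm]
  ring

lemma pres_eq (l z x y : ℝ) : pres l x y z = srad x y ^ (l - 1) *
    (2 * l * z * Real.cos (l * (3 * π / 2)) * Real.sin ((l - 1) * sphi x y)
      + -(2 * l * z * (1 + Real.sin (l * (3 * π / 2)))) * Real.cos ((l - 1) * sphi x y)) := by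
  rw [pres, sin_add_three_pi_div_two, Real.sin_sub]
  ring

lemma offAxis_of_sector {r φ : ℝ} (hr : 0 < r) (hφ0 : 0 < φ) (hφ1 : φ < 2 * π) :
    OffAxis (r * Real.cos φ) (r * Real.sin φ) := by
  rcases eq_or_ne (Real.sin φ) 0 with h | h
  · have h1 : Real.sin (φ - π) = 0 := by rw [Real.sin_sub_pi, h, neg_zero]
    have h2 := (Real.sin_eq_zero_iff_of_lt_of_lt (by linarith) (by linarith)).1 h1
    have h3 : φ = π := by linarith
    exact Or.inl (by rw [h3, Real.cos_pi]; linarith)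
  · exact Or.inr (mul_ne_zero hr.ne' h)

lemma deriv_deriv_mul_const (c a : ℝ) : deriv (deriv fun t : ℝ => t * c) a = 0 := by
  simp

/-- For the manufactured 3D example, `f = −Δu + ∇p` has vanishing first and second
components on `Ω`: `Δu₁ = ∂p/∂x`, `Δu₂ = ∂p/∂y`, `Δu₃ = 0`, so that
`f = (0, 0, ∂p/∂z)` with `∂p/∂z = 2λ r^{λ−1}[sin((λ−1)φ+ω) + sin((λ−1)φ−λω)]`. -/
theorem stmt13 (l : ℝ) (hl : l ∈ Set.Ioo (0 : ℝ) 1)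
    (hsin : Real.sin (3 * π / 2 * l) = l)
    (r φ z : ℝ) (hr0 : 0 < r) (hr1 : r < 1)
    (hφ0 : 0 < φ) (hφ1 : φ < 3 * π / 2) (hz0 : 0 < z) (hz1 : z < 1) :
    (deriv (deriv (fun t => u1 l t (r * Real.sin φ) z)) (r * Real.cos φ)
        + deriv (deriv (fun t => u1 l (r * Real.cos φ) t z)) (r * Real.sin φ)
        + deriv (deriv (fun t => u1 l (r * Real.cos φ) (r * Real.sin φ) t)) z
      = deriv (fun t => pres l t (r * Real.sin φ) z) (r * Real.cos φ)) ∧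
    (deriv (deriv (fun t => u2 l t (r * Real.sin φ) z)) (r * Real.cos φ)
        + deriv (deriv (fun t => u2 l (r * Real.cos φ) t z)) (r * Real.sin φ)
        + deriv (deriv (fun t => u2 l (r * Real.cos φ) (r * Real.sin φ) t)) z
      = deriv (fun t => pres l (r * Real.cos φ) t z) (r * Real.sin φ)) ∧
    (deriv (deriv (fun t => u3 t (r * Real.sin φ) z)) (r * Real.cos φ)
        + deriv (deriv (fun t => u3 (r * Real.cos φ) t z)) (r * Real.sin φ)
        + deriv (deriv (fun t => u3 (r * Real.cos φ) (r * Real.sin φ) t)) z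
      = 0) ∧
    (deriv (fun t => pres l (r * Real.cos φ) (r * Real.sin φ) t) z
      = 2 * l * srad (r * Real.cos φ) (r * Real.sin φ) ^ (l - 1) *
          (Real.sin ((l - 1) * sphi (r * Real.cos φ) (r * Real.sin φ) + 3 * π / 2)
            + Real.sin ((l - 1) * sphi (r * Real.cos φ) (r * Real.sin φ)
                - l * (3 * π / 2)))) := by
  have h := offAxis_of_sector hr0 hφ0 (by linarith : φ < 2 * π)
  refine ⟨?_, ?_, ?_, ?_⟩
  · have hz : deriv (deriv fun t => u1 l (r * Real.cos φ) (r * Real.sin φ) t) z = 0 := by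
      simp only [u1, mul_assoc]
      exact deriv_deriv_mul_const _ _
    rw [hz, h.laplacian_biharmonic _ _ _ _ _ (u1_eq l z),
      h.deriv_harmonic_left _ _ _ (pres_eq l z), show l - 1 - 1 = l - 2 by ring]
    ring
  · have hz : deriv (deriv fun t => u2 l (r * Real.cos φ) (r * Real.sin φ) t) z = 0 := by
      simp only [u2, mul_assoc]
      exact deriv_deriv_mul_const _ _
    rw [hz, h.laplacian_biharmonic _ _ _ _ _ (u2_eq l z),
      h.deriv_harmonic_right _ _ _ (pres_eq l z), show l - 1 - 1 = l - 2 by ring]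
    ring
  · have hz : deriv (deriv fun t => u3 (r * Real.cos φ) (r * Real.sin φ) t) z = 0 := by
      simp [u3]
    rw [hz, h.laplacian_biharmonic _ _ _ _ _ (u3_eq z)]
    ring
  · simp only [pres, mul_assoc, deriv_const_mul_field', deriv_id'', deriv_mul_const_field']
    simp
end
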